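/- Let h = ℝ⁷ with basis (e₁,…,e₇) and Lie bracket determined by the non-vanishing relations [e₁,e₃] = √2 e₇, [e₂,e₄] = √2 e₇, [e₄,e₅] = −e₁, [e₄,e₆] = −e₁, [e₃,e₅] = −e₂, [e₃,e₆] = −e₂, and let ⟨·,·⟩ be the Lorentzian inner product for which (e₁,…,e₇) is orthonormal with ⟨e₁,e₁⟩ = −1. Then (h,⟨·,·⟩) is a Ricci-flat 3-step nilpotent Lorentzian Lie algebra whose center is Z(h) = span{e₇, e₅ − e₆}, which is nondegenerate with respect to ⟨·,·⟩. -/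

import Mathlib

open Module LinearMap

noncomputable section

section Orthonormal

variable {ι H : Type*} [Fintype ι] [DecidableEq ι] [AddCommGroup H] [Module ℝ H]

/-- Coordinates with respect to a pseudo-orthonormal basis. -/
theorem repr_eq_of_pseudo_orthonormal (b : Basis ι ℝ H) (B : H →ₗ[ℝ] H →ₗ[ℝ] ℝ) (ε : ι → ℝ)
    (hε : ∀ i, ε i * ε i = 1) (hB : ∀ i j, B (b i) (b j) = if i = j then ε i else 0)
    (u : H) (i : ι) : b.repr u i = ε i * B u (b i) := by
  conv_rhs => rw [← b.sum_repr u]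
  simp only [map_sum, map_smul, LinearMap.sum_apply, LinearMap.smul_apply, smul_eq_mul, hB]
  simp [mul_comm (ε i), mul_assoc, hε]

/-- The trace of an endomorphism in terms of a pseudo-orthonormal basis. -/
theorem trace_eq_sum_of_pseudo_orthonormal (b : Basis ι ℝ H) (B : H →ₗ[ℝ] H →ₗ[ℝ] ℝ) (ε : ι → ℝ)
    (hε : ∀ i, ε i * ε i = 1) (hB : ∀ i j, B (b i) (b j) = if i = j then ε i else 0)
    (f : Module.End ℝ H) : LinearMap.trace ℝ H f = ∑ i, ε i * B (f (b i)) (b i) := by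
  rw [LinearMap.trace_eq_matrix_trace ℝ b, Matrix.trace]
  refine Finset.sum_congr rfl fun i _ => ?_
  rw [Matrix.diag_apply, LinearMap.toMatrix_apply,
    repr_eq_of_pseudo_orthonormal b B ε hε hB]

end Orthonormal

section Traces

variable {ι H : Type*} [Fintype ι] [DecidableEq ι] [LieRing H] [LieAlgebra ℝ H]

/-- `tr (ad u ∘ (ad v)*)` in terms of a pseudo-orthonormal basis. -/
theorem trace_ad_comp_adjoint (b : Basis ι ℝ H) (B : H →ₗ[ℝ] H →ₗ[ℝ] ℝ) (ε : ι → ℝ)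
    (hε : ∀ i, ε i * ε i = 1) (hB : ∀ i j, B (b i) (b j) = if i = j then ε i else 0)
    (u v : H) (f : Module.End ℝ H) (hf : ∀ x w, B (f x) w = B x ⁅v, w⁆) :
    LinearMap.trace ℝ H ((LieAlgebra.ad ℝ H u : Module.End ℝ H) ∘ₗ f) =
      ∑ i, ε i * B ⁅u, b i⁆ ⁅v, b i⁆ := by
  have : Module.Finite ℝ H := Module.Finite.of_basis b
  rw [LinearMap.trace_comp_comm', trace_eq_sum_of_pseudo_orthonormal b B ε hε hB]
  simp [hf]

/-- `tr (J u ∘ J v)` in terms of a pseudo-orthonormal basis. -/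
theorem trace_J_comp_J (b : Basis ι ℝ H) (B : H →ₗ[ℝ] H →ₗ[ℝ] ℝ) (ε : ι → ℝ)
    (hε : ∀ i, ε i * ε i = 1) (hB : ∀ i j, B (b i) (b j) = if i = j then ε i else 0)
    (J : H → Module.End ℝ H) (hJ : ∀ u v w, B (J u v) w = B u ⁅v, w⁆) (u v : H) :
    LinearMap.trace ℝ H (J u ∘ₗ J v) =
      ∑ i, ∑ j, ε i * ε j * B v ⁅b i, b j⁆ * B u ⁅b j, b i⁆ := by
  rw [trace_eq_sum_of_pseudo_orthonormal b B ε hε hB]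
  refine Finset.sum_congr rfl fun i _ => ?_
  have h : J v (b i) = ∑ j, (ε j * B v ⁅b i, b j⁆) • b j := by
    conv_lhs => rw [← b.sum_repr (J v (b i))]
    refine Finset.sum_congr rfl fun j _ => ?_
    rw [repr_eq_of_pseudo_orthonormal b B ε hε hB, hJ]
  rw [LinearMap.comp_apply, h]
  simp only [map_sum, map_smul, LinearMap.sum_apply, LinearMap.smul_apply, smul_eq_mul, hJ,
    Finset.mul_sum]
  exact Finset.sum_congr rfl fun j _ => by ring

end Traces

section Bracket

variable {H : Type*} [LieRing H] [LieAlgebra ℝ H]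

/-- The bracket in coordinates. -/
theorem lie_eq_of_relations (b : Basis (Fin 7) ℝ H)
    (h13 : ⁅b 0, b 2⁆ = Real.sqrt 2 • b 6)
    (h24 : ⁅b 1, b 3⁆ = Real.sqrt 2 • b 6)
    (h45 : ⁅b 3, b 4⁆ = - b 0)
    (h46 : ⁅b 3, b 5⁆ = - b 0)
    (h35 : ⁅b 2, b 4⁆ = - b 1)
    (h36 : ⁅b 2, b 5⁆ = - b 1)
    (hrest : ∀ i j : Fin 7, i < j →
      (i, j) ∉ ({(0,2), (1,3), (3,4), (3,5), (2,4), (2,5)} : Set (Fin 7 × Fin 7)) →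
      ⁅b i, b j⁆ = 0) (u v : H) :
    ⁅u, v⁆ =
      ((b.repr u 4 + b.repr u 5) * b.repr v 3 - b.repr u 3 * (b.repr v 4 + b.repr v 5)) • b 0 +
      ((b.repr u 4 + b.repr u 5) * b.repr v 2 - b.repr u 2 * (b.repr v 4 + b.repr v 5)) • b 1 +
      (Real.sqrt 2 * (b.repr u 0 * b.repr v 2 - b.repr u 2 * b.repr v 0 +
        b.repr u 1 * b.repr v 3 - b.repr u 3 * b.repr v 1)) • b 6 := by
  have hneg : ∀ {i j : Fin 7} {x : H}, ⁅b i, b j⁆ = x → ⁅b j, b i⁆ = -x := by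
    rintro i j x rfl
    exact (lie_skew _ _).symm
  have hzero : ∀ i j : Fin 7,
      (i, j) ∉ ({(0,2), (1,3), (3,4), (3,5), (2,4), (2,5)} : Set (Fin 7 × Fin 7)) →
      (j, i) ∉ ({(0,2), (1,3), (3,4), (3,5), (2,4), (2,5)} : Set (Fin 7 × Fin 7)) →
      ⁅b i, b j⁆ = 0 := by
    intro i j hij hji
    rcases lt_trichotomy i j with h | rfl | h
    · exact hrest i j h hij
    · exact lie_self _
    · rw [hneg (hrest j i h hji), neg_zero]
  conv_lhs => rw [← b.sum_repr u, ← b.sum_repr v]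
  simp only [Fin.sum_univ_seven, add_lie, lie_add, smul_lie, lie_smul, h13, h24, h45, h46, h35,
    h36, hneg h13, hneg h24, hneg h45, hneg h46, hneg h35, hneg h36]
  simp (disch := simp) only [hzero]
  module

end Bracket

/-- The 7-dimensional Lie algebra with the given structure constants and the
Lorentzian metric making the basis orthonormal with `⟨e₁,e₁⟩ = −1` is a Ricci-flat 3-step
nilpotent Lorentzian Lie algebra with nondegenerate center `span{e₇, e₅ − e₆}`.
(Here `e₁,…,e₇` are `b 0, …, b 6`.) -/
theorem statement17
    {H : Type*} [LieRing H] [LieAlgebra ℝ H] [Module.Finite ℝ H]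
    (b : Basis (Fin 7) ℝ H)
    -- the non-vanishing brackets
    (h13 : ⁅b 0, b 2⁆ = Real.sqrt 2 • b 6)
    (h24 : ⁅b 1, b 3⁆ = Real.sqrt 2 • b 6)
    (h45 : ⁅b 3, b 4⁆ = - b 0)
    (h46 : ⁅b 3, b 5⁆ = - b 0)
    (h35 : ⁅b 2, b 4⁆ = - b 1)
    (h36 : ⁅b 2, b 5⁆ = - b 1)
    -- all other brackets of basis vectors vanish
    (hrest : ∀ i j : Fin 7, i < j →
      (i, j) ∉ ({(0,2), (1,3), (3,4), (3,5), (2,4), (2,5)} : Set (Fin 7 × Fin 7)) →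
      ⁅b i, b j⁆ = 0)
    -- the Lorentzian inner product making `b` orthonormal with `⟨e₁,e₁⟩ = −1`
    (B : H →ₗ[ℝ] H →ₗ[ℝ] ℝ)
    (hsymm : ∀ u v : H, B u v = B v u)
    (horth : ∀ i j : Fin 7, i ≠ j → B (b i) (b j) = 0)
    (htime : B (b 0) (b 0) = -1)
    (hspace : ∀ i : Fin 7, i ≠ 0 → B (b i) (b i) = 1)
    -- `adStar u` is the adjoint of `ad u` with respect to `B`
    (adStar : H → Module.End ℝ H)
    (hadStar : ∀ u v w : H, B (adStar u v) w = B v ⁅u, w⁆)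
    -- `Jm u` is the skew-symmetric endomorphism `J_u(v) = ad_v*(u)`
    (Jm : H → Module.End ℝ H)
    (hJm : ∀ u v w : H, B (Jm u v) w = B u ⁅v, w⁆) :
    -- `(h, ⟨·,·⟩)` is Ricci-flat ...
    (∀ u v : H,
      -(1/2) * LinearMap.trace ℝ H ((LieAlgebra.ad ℝ H u : Module.End ℝ H) ∘ₗ adStar v)
        - (1/4) * LinearMap.trace ℝ H (Jm u ∘ₗ Jm v) = 0) ∧
    -- ... 3-step nilpotent: `C⁴(h) = 0` and `C³(h) ≠ 0` ...
    (LieModule.lowerCentralSeries ℝ H H 3 = ⊥ ∧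
      LieModule.lowerCentralSeries ℝ H H 2 ≠ ⊥) ∧
    -- ... with center `span{e₇, e₅ − e₆}` ...
    (LieAlgebra.center ℝ H).toSubmodule = Submodule.span ℝ {b 6, b 4 - b 5} ∧
    -- ... which is nondegenerate
    (∀ z ∈ LieAlgebra.center ℝ H,
      (∀ w ∈ LieAlgebra.center ℝ H, B z w = 0) → z = 0) := by
  have hlie := lie_eq_of_relations b h13 h24 h45 h46 h35 h36 hrest
  let ε : Fin 7 → ℝ := fun i => if i = 0 then -1 else 1
  have hε : ∀ i, ε i * ε i = 1 := by
    intro i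
    by_cases h : i = 0 <;> simp [ε, h]
  have hB : ∀ i j, B (b i) (b j) = if i = j then ε i else 0 := by
    intro i j
    by_cases hij : i = j
    · subst hij
      by_cases h : i = 0
      · subst h
        simpa [ε] using htime
      · simpa [ε, h] using hspace i h
    · simpa [hij] using horth i j hij
  have hrepr := repr_eq_of_pseudo_orthonormal b B ε hε hB
  have hs : Real.sqrt 2 * Real.sqrt 2 = 2 := Real.mul_self_sqrt (by norm_num)
  have hs' : Real.sqrt 2 ≠ 0 := by positivity
  have hb : ∀ i j, b.repr (b i) j = if i = j then (1 : ℝ) else 0 := fun i j => by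
    rw [b.repr_self, Finsupp.single_apply]
  have hBu : ∀ u i, B u (b i) = ε i * b.repr u i := fun u i => by
    rw [hrepr, ← mul_assoc, hε, one_mul]
  have hcenter : ∀ z : H, z ∈ LieAlgebra.center ℝ H ↔
      z ∈ Submodule.span ℝ {b 6, b 4 - b 5} := by
    intro z
    rw [LieModule.mem_maxTrivSubmodule, Submodule.mem_span_pair]
    constructor
    · intro hz
      have hc : ∀ i j, b.repr ⁅b i, z⁆ j = 0 := fun i j => by simp [hz]
      have h0 := hc 0 6
      have h1 := hc 1 6
      have h2 := hc 2 6
      have h3 := hc 3 6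
      have h4 := hc 3 0
      simp [hlie, hs'] at h0 h1 h2 h3 h4
      refine ⟨b.repr z 6, b.repr z 4, ?_⟩
      conv_rhs => rw [← b.sum_repr z]
      have h5 : b.repr z 5 = - b.repr z 4 := by linarith
      simp only [Fin.sum_univ_seven, h0, h1, h2, h3, h5]
      module
    · rintro ⟨s, t, rfl⟩ x
      rw [hlie]
      simp
  refine ⟨?_, ⟨?_, ?_⟩, ?_, ?_⟩
  · intro u v
    rw [trace_ad_comp_adjoint b B ε hε hB u v (adStar v) (hadStar v),
      trace_J_comp_J b B ε hε hB Jm hJm]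
    simp only [hlie, hb, map_add, map_smul, LinearMap.add_apply, LinearMap.smul_apply, smul_eq_mul,
      hBu, Fin.sum_univ_seven, ε]
    simp
    ring_nf
    simp [Real.sq_sqrt]
    ring
  · simp only [LieModule.lowerCentralSeries_succ, LieModule.lowerCentralSeries_zero]
    have htriv : ∀ m ∈ ⁅(⊤ : LieIdeal ℝ H), (⊤ : LieSubmodule ℝ H H)⁆,
        ∀ x y : H, ⁅x, ⁅y, m⁆⁆ = 0 := by
      intro m hm
      rw [← LieSubmodule.mem_toSubmodule, LieSubmodule.lieIdeal_oper_eq_linear_span'] at hm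
      induction hm using Submodule.span_induction with
      | mem m hm =>
        obtain ⟨p, -, q, -, rfl⟩ := hm
        intro x y
        simp only [hlie, map_add, map_smul, Finsupp.add_apply, Finsupp.smul_apply, hb]
        simp
      | zero => simp
      | add m n _ _ hm hn => simp [hm, hn]
      | smul t m _ hm => simp [hm]
    have hle : ⁅(⊤ : LieIdeal ℝ H), ⁅(⊤ : LieIdeal ℝ H), (⊤ : LieSubmodule ℝ H H)⁆⁆ ≤
        LieModule.maxTrivSubmodule ℝ H H :=
      (LieSubmodule.lie_le_iff _ _ _).2 fun y _ m hm =>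
        (LieModule.mem_maxTrivSubmodule _ _ _ _).2 fun x => htriv m hm x y
    refine eq_bot_iff.2 ((LieSubmodule.lie_le_iff _ _ _).2 fun x _ m hm => ?_)
    exact (LieSubmodule.mem_bot _).2 ((LieModule.mem_maxTrivSubmodule _ _ _ _).1 (hle hm) x)
  · intro h
    have hmem : ⁅b 2, ⁅b 3, b 4⁆⁆ ∈ LieModule.lowerCentralSeries ℝ H H 2 := by
      simp only [LieModule.lowerCentralSeries_succ, LieModule.lowerCentralSeries_zero]
      exact LieSubmodule.lie_mem_lie (LieSubmodule.mem_top _)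
        (LieSubmodule.lie_mem_lie (LieSubmodule.mem_top _) (LieSubmodule.mem_top _))
    rw [h, LieSubmodule.mem_bot, h45, lie_neg, lie_skew, h13, smul_eq_zero] at hmem
    exact hmem.elim hs' (b.ne_zero 6)
  · ext z
    exact hcenter z
  · intro z hz hw
    have h6 := hw (b 6) ((hcenter _).2 (Submodule.subset_span (by simp)))
    have h45 := hw (b 4 - b 5) ((hcenter _).2 (Submodule.subset_span (by simp)))
    obtain ⟨s, t, rfl⟩ := Submodule.mem_span_pair.1 ((hcenter z).1 hz)
    simp [hB, ε] at h6 h45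
    have ht : t = 0 := by linarith
    simp [h6, ht]
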